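/- Let K be a finite geometric simplicial complex with polyhedron A = |K| ⊆ ℝ^N, and let K_1,…,K_n be subcomplexes of K with A = A_1 ∪ ⋯ ∪ A_n, where A_i = |K_i|. For indices i_0 < ⋯ < i_p write A_{i_0,…,i_p} = A_{i_0} ∩ ⋯ ∩ A_{i_p}. Assume each A_i is nonempty and acyclic over ℚ, i.e. dim_ℚ H_0(A_i;ℚ) = 1 and H_q(A_i;ℚ) = 0 for all q > 0 (singular homology with rational coefficients). Let δ_1 : ∏_i LC(A_i,ℚ) → ∏_{i<j} LC(A_{i,j},ℚ) be the ℚ-linear map (δ_1 φ)_{i,j} = φ_j|_{A_{i,j}} − φ_i|_{A_{i,j}}, and δ_2 : ∏_{i<j} LC(A_{i,j},ℚ) → ∏_{i<j<l} LC(A_{i,j,l},ℚ) the ℚ-linear map (δ_2 φ)_{i,j,l} = φ_{j,l}|_{A_{i,j,l}} − φ_{i,l}|_{A_{i,j,l}} + φ_{i,j}|_{A_{i,j,l}}, where LC(X,ℚ) denotes the ℚ-vector space of locally constant functions X → ℚ (with LC(∅,ℚ) = 0). Then the first Betti number of A satisfies b_1(A) = dim_ℚ H_1(A;ℚ) = dim_ℚ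 ker(δ_2) − dim_ℚ im(δ_1). -/

import Mathlib

open CategoryTheory Set

noncomputable section

/-- The singular chain complex of a topological space with rational coefficients:
the complex of free `ℚ`-modules on the singular simplicial set. -/
def singularChainComplexQ (X : Type) [TopologicalSpace X] :
    ChainComplex (ModuleCat ℚ) ℕ :=
  (AlgebraicTopology.alternatingFaceMapComplex (ModuleCat ℚ)).obj
    (TopCat.toSSet.obj (TopCat.of X) ⋙ ModuleCat.free ℚ)

/-- Singular homology with rational coefficients. -/
def singularHomologyQ (X : Type) [TopologicalSpace X] (q : ℕ) : ModuleCat ℚ :=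
  (singularChainComplexQ X).homology q

/-- Pairs of indices `i < j`. -/
abbrev PairIdx (n : ℕ) := {p : Fin n × Fin n // p.1 < p.2}

/-- Triples of indices `i < j < l`. -/
abbrev TripleIdx (n : ℕ) := {q : Fin n × Fin n × Fin n // q.1 < q.2.1 ∧ q.2.1 < q.2.2}


theorem inter3_subset_right_right {α : Type*} {s t u : Set α} :
    (s ∩ t) ∩ u ⊆ t ∩ u := fun _ hx => ⟨hx.1.2, hx.2⟩

theorem inter3_subset_left_right {α : Type*} {s t u : Set α} :
    (s ∩ t) ∩ u ⊆ s ∩ u := fun _ hx => ⟨hx.1.1, hx.2⟩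

/-- Over a field, functionals on the middle homology of a short complex are classes of functionals
on the middle term. -/
theorem exists_dual_homology_of_shortComplex {M₁ M₂ M₃ : ModuleCat.{0} ℚ}
    (f : M₁ ⟶ M₂) (g : M₂ ⟶ M₃) (w : f ≫ g = 0) :
    ∃ Φ : LinearMap.ker (LinearMap.lcomp ℚ ℚ f.hom) →ₗ[ℚ]
        Module.Dual ℚ (ShortComplex.mk f g w).homology,
      Function.Surjective Φ ∧ ∀ l, Φ l = 0 ↔ ∃ m : M₃ →ₗ[ℚ] ℚ, l.1 = m ∘ₗ g.hom := by
  let S := ShortComplex.mk f g w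
  let W := LinearMap.range S.moduleCatToCycles
  let e : S.homology ≃ₗ[ℚ] (LinearMap.ker g.hom ⧸ W) := S.moduleCatHomologyIso.toLinearEquiv
  let D := Module.Dual ℚ (LinearMap.ker g.hom ⧸ W)
  have hW (l : LinearMap.ker (LinearMap.lcomp ℚ ℚ f.hom)) :
      W ≤ LinearMap.ker (l.1 ∘ₗ (LinearMap.ker g.hom).subtype) := by
    rintro _ ⟨x, rfl⟩
    exact LinearMap.congr_fun l.2 x
  let Φ₀ : LinearMap.ker (LinearMap.lcomp ℚ ℚ f.hom) →ₗ[ℚ] D :=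
    { toFun := fun l => W.liftQ _ (hW l)
      map_add' := fun _ _ => Submodule.linearMap_qext _ rfl
      map_smul' := fun _ _ => Submodule.linearMap_qext _ rfl }
  refine ⟨e.dualMap.toLinearMap ∘ₗ Φ₀, e.dualMap.surjective.comp ?_, fun l => ?_⟩
  · intro d
    obtain ⟨l, hl⟩ := LinearMap.exists_extend (d ∘ₗ W.mkQ)
    refine ⟨⟨l, ?_⟩, Submodule.linearMap_qext _ hl⟩
    rw [LinearMap.mem_ker]
    ext x
    have h := LinearMap.congr_fun hl (S.moduleCatToCycles x)
    simpa [(Submodule.Quotient.mk_eq_zero W).2 (LinearMap.mem_range_self S.moduleCatToCycles x)]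
      using! h
  · have h0 : e.dualMap (Φ₀ l) = 0 ↔ Φ₀ l = 0 := e.dualMap.map_eq_zero_iff
    refine h0.trans ⟨fun h => ?_, ?_⟩
    · have hl : l.1 ∈ (LinearMap.ker g.hom).dualAnnihilator := by
        rw [Submodule.mem_dualAnnihilator]
        exact fun x hx => LinearMap.congr_fun h (W.mkQ ⟨x, hx⟩)
      rw [← LinearMap.range_dualMap_eq_dualAnnihilator_ker] at hl
      exact hl.imp fun m hm => hm.symm
    · rintro ⟨m, hm⟩
      refine Submodule.linearMap_qext _ (LinearMap.ext fun x => ?_)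
      change l.1 x = 0
      rw [hm]
      simp [LinearMap.mem_ker.1 x.2]

/-- The inclusion of the `i`-th face of the standard simplex. -/
def simplexFace {n : ℕ} (i : Fin (n + 2)) :
    C(stdSimplex ℝ (Fin (n + 1)), stdSimplex ℝ (Fin (n + 2))) :=
  ⟨stdSimplex.map i.succAbove, stdSimplex.continuous_map _⟩

/-- Rational singular 1-cocycles. -/
def singularCocycles (X : Type) [TopologicalSpace X] :
    Submodule ℚ (C(stdSimplex ℝ (Fin 2), X) → ℚ) where
  carrier := {c | ∀ σ : C(stdSimplex ℝ (Fin 3), X),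
    c (σ.comp (simplexFace 0)) - c (σ.comp (simplexFace 1)) + c (σ.comp (simplexFace 2)) = 0}
  zero_mem' := by simp
  add_mem' := by
    intro a b ha hb σ
    simp only [Pi.add_apply]
    linear_combination ha σ + hb σ
  smul_mem' := by
    intro r a ha σ
    simp only [Pi.smul_apply, smul_eq_mul]
    linear_combination r * ha σ

/-- A rational singular 1-cochain is the coboundary of a function. -/
def IsSingularCoboundary {X : Type} [TopologicalSpace X]
    (c : C(stdSimplex ℝ (Fin 2), X) → ℚ) : Prop :=
  ∃ f : X → ℚ, ∀ γ, c γ = f (γ (stdSimplex.vertex 1)) - f (γ (stdSimplex.vertex 0))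

section
variable (X : Type) [TopologicalSpace X]

open Simplicial

/-- Cochains as functionals on the singular chain complex. -/
def singularCochainEquiv (q : ℕ) :
    (C(stdSimplex ℝ (Fin (q + 1)), X) → ℚ) ≃ₗ[ℚ] ((singularChainComplexQ X).X q →ₗ[ℚ] ℚ) :=
  (LinearEquiv.funCongrLeft ℚ ℚ (TopCat.toSSetObjEquiv (TopCat.of X) (.op ⦋q⦌))).trans
    (Finsupp.llift ℚ ℚ ℚ ((TopCat.toSSet.obj (TopCat.of X)).obj (.op ⦋q⦌)))

/-- The basis chain given by a singular simplex. -/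
def singularBasisChain (q : ℕ) (σ : C(stdSimplex ℝ (Fin (q + 1)), X)) :
    (singularChainComplexQ X).X q :=
  ModuleCat.freeMk ((TopCat.toSSetObjEquiv (TopCat.of X) (.op ⦋q⦌)).symm σ)

theorem singularCochainEquiv_basisChain (q : ℕ) (c : C(stdSimplex ℝ (Fin (q + 1)), X) → ℚ) (σ) :
    singularCochainEquiv X q c (singularBasisChain X q σ) = c σ := by
  unfold singularCochainEquiv singularBasisChain ModuleCat.freeMk
  erw [LinearEquiv.trans_apply, Finsupp.llift_apply, Finsupp.lift_apply]
  simp [LinearEquiv.funCongrLeft_apply, LinearMap.funLeft_apply]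

theorem singularChain_functional_ext {q : ℕ} {l m : (singularChainComplexQ X).X q →ₗ[ℚ] ℚ}
    (h : ∀ σ, l (singularBasisChain X q σ) = m (singularBasisChain X q σ)) : l = m := by
  obtain ⟨c, rfl⟩ := (singularCochainEquiv X q).surjective l
  obtain ⟨d, rfl⟩ := (singularCochainEquiv X q).surjective m
  congr 1
  ext σ
  simpa only [singularCochainEquiv_basisChain] using h σ

theorem singularChain_d_basisChain (q : ℕ) (σ : C(stdSimplex ℝ (Fin (q + 2)), X)) :
    (singularChainComplexQ X).d (q + 1) q (singularBasisChain X (q + 1) σ) =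
      ∑ i : Fin (q + 2), (-1 : ℤ) ^ (i : ℕ) • singularBasisChain X q (σ.comp (simplexFace i)) := by
  have key {M N : ModuleCat.{0} ℚ} (g : Fin (q + 2) → (M ⟶ N)) (x : M) :
      (∑ i : Fin (q + 2), (-1 : ℤ) ^ (i : ℕ) • g i) x =
        ∑ i : Fin (q + 2), (-1 : ℤ) ^ (i : ℕ) • g i x := by
    simp [ModuleCat.hom_sum, LinearMap.sum_apply]
  have h : (singularChainComplexQ X).d (q + 1) q = _ :=
    AlgebraicTopology.AlternatingFaceMapComplex.obj_d_eq _ q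
  rw [h]
  refine (key _ _).trans (Finset.sum_congr rfl fun i _ => ?_)
  congr 1
  exact ModuleCat.free_map_apply _ _

/-- Functionals on the first homology group are classes of 1-cocycles. -/
theorem exists_dual_singularHomology_one :
    ∃ Φ : singularCocycles X →ₗ[ℚ] Module.Dual ℚ (singularHomologyQ X 1),
      Function.Surjective Φ ∧ ∀ c, Φ c = 0 ↔ IsSingularCoboundary c.1 := by
  let C := singularChainComplexQ X
  let e : singularHomologyQ X 1 ≃ₗ[ℚ]
      (ShortComplex.mk (C.d 2 1) (C.d 1 0) (C.d_comp_d 2 1 0)).homology :=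
    (ShortComplex.homologyMapIso
      (C.isoSc' 2 1 0 (by simp) (by simp))).toLinearEquiv
  obtain ⟨Φ, hΦ, hΦ0⟩ := exists_dual_homology_of_shortComplex _ _ (C.d_comp_d 2 1 0)
  have hS (c : C(stdSimplex ℝ (Fin 2), X) → ℚ) :
      singularCochainEquiv X 1 c ∈ LinearMap.ker (LinearMap.lcomp ℚ ℚ (C.d 2 1).hom) ↔
        c ∈ singularCocycles X := by
    rw [LinearMap.mem_ker]
    have h1 (σ) : LinearMap.lcomp ℚ ℚ (C.d 2 1).hom (singularCochainEquiv X 1 c)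
        (singularBasisChain X 2 σ) = c (σ.comp (simplexFace 0)) - c (σ.comp (simplexFace 1)) +
          c (σ.comp (simplexFace 2)) := by
      refine (congrArg (singularCochainEquiv X 1 c)
        (singularChain_d_basisChain X 1 σ)).trans ?_
      rw [map_sum, Fin.sum_univ_three]
      simp only [map_zsmul, singularCochainEquiv_basisChain]
      simp
      ring
    constructor
    · intro h σ
      rw [← h1, h, LinearMap.zero_apply]
    · intro h
      refine singularChain_functional_ext X fun σ => ?_
      rw [h1, h σ, LinearMap.zero_apply]
  let Θ : singularCocycles X ≃ₗ[ℚ] LinearMap.ker (LinearMap.lcomp ℚ ℚ (C.d 2 1).hom) :=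
    (singularCochainEquiv X 1).ofSubmodules _ _ (by
      ext l
      obtain ⟨c, rfl⟩ := (singularCochainEquiv X 1).surjective l
      rw [hS]
      exact (singularCochainEquiv X 1).injective.mem_set_image)
  refine ⟨e.dualMap.toLinearMap ∘ₗ Φ ∘ₗ Θ.toLinearMap,
    e.dualMap.surjective.comp (hΦ.comp Θ.surjective), fun c => ?_⟩
  have h0 : e.dualMap (Φ (Θ c)) = 0 ↔ Φ (Θ c) = 0 := e.dualMap.map_eq_zero_iff
  refine (h0.trans (hΦ0 _)).trans ?_
  have h1 (m : (singularChainComplexQ X).X 0 →ₗ[ℚ] ℚ) (γ) :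
      (m ∘ₗ (C.d 1 0).hom) (singularBasisChain X 1 γ) =
        m (singularBasisChain X 0 (γ.comp (simplexFace 0))) -
          m (singularBasisChain X 0 (γ.comp (simplexFace 1))) := by
    refine (congrArg m (singularChain_d_basisChain X 0 γ)).trans ?_
    rw [map_sum, Fin.sum_univ_two]
    simp only [map_zsmul]
    simp
    ring
  have hγ (γ : C(stdSimplex ℝ (Fin 2), X)) (i : Fin 2) :
      γ.comp (simplexFace i) = .const _ (γ (stdSimplex.vertex (i.succAbove 0))) := by
    ext x
    obtain rfl : x = stdSimplex.vertex 0 := Subsingleton.elim _ _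
    exact congrArg γ (stdSimplex.map_vertex _ _)
  constructor
  · rintro ⟨m, hm⟩
    refine ⟨fun x => m (singularBasisChain X 0 (.const _ x)), fun γ => ?_⟩
    rw [← singularCochainEquiv_basisChain X 1 c.1 γ]
    refine (LinearMap.congr_fun hm _).trans ((h1 m γ).trans ?_)
    rw [hγ, hγ]
    rfl
  · rintro ⟨f, hf⟩
    refine ⟨singularCochainEquiv X 0 fun σ => f (σ (stdSimplex.vertex 0)),
      singularChain_functional_ext X fun γ => ?_⟩
    refine (singularCochainEquiv_basisChain X 1 c.1 γ).trans (Eq.trans ?_ (h1 _ γ).symm)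
    rw [singularCochainEquiv_basisChain, singularCochainEquiv_basisChain, hγ, hγ, hf]
    rfl

end

section LocalPrimitive

open unitInterval

variable {B R : Type*} [TopologicalSpace B] [AddCommGroup R] (W : B → Set B) (F : B → B → R)

/-- The bundle of germs of primitives of a family of local functions whose increments agree. -/
def primitiveBundleCore [TopologicalSpace R] [DiscreteTopology R]
    (hWo : ∀ x, IsOpen (W x)) (hW : ∀ x, x ∈ W x)
    (hF : ∀ x y, ∀ z ∈ W x ∩ W y, ∀ᶠ w in nhds z, F x w - F x z = F y w - F y z) :
    FiberBundleCore B B R where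
  baseSet := W
  isOpen_baseSet := hWo
  indexAt := id
  mem_baseSet_at := hW
  coordChange i j x q := q + F i x - F j x
  coordChange_self i x _ v := by simp
  continuousOn_coordChange i j := by
    rintro ⟨z, q⟩ hz
    refine ContinuousAt.continuousWithinAt ?_
    rw [ContinuousAt, nhds_discrete R, Filter.tendsto_pure, nhds_prod_eq, nhds_discrete R,
      Filter.prod_pure, Filter.eventually_map]
    filter_upwards [hF i j z hz.1] with w hw
    rw [sub_eq_sub_iff_sub_eq_sub] at hw
    rw [add_sub_assoc, add_sub_assoc, hw]
  coordChange_comp i j k x _ v := by abel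

/-- A family of local functions whose increments agree has a primitive along each continuous map
from a convex set. -/
theorem exists_local_primitive (hWo : ∀ x, IsOpen (W x)) (hW : ∀ x, x ∈ W x)
    (hF : ∀ x y, ∀ z ∈ W x ∩ W y, ∀ᶠ w in nhds z, F x w - F x z = F y w - F y z)
    {V : Type*} [NormedAddCommGroup V] [NormedSpace ℝ V] {C : Set V} (hC : Convex ℝ C)
    (h : C(C, B)) :
    ∃ G : C → R, ∀ a, ∀ᶠ b in nhds a, G b - G a = F (h a) (h b) - F (h a) (h a) := by
  let _ : TopologicalSpace R := ⊥
  have _ : DiscreteTopology R := ⟨rfl⟩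
  let Z := primitiveBundleCore W F hWo hW hF
  have cov : IsCoveringMap Z.proj := FiberBundle.isCoveringMap
  obtain hC0 | ⟨⟨a₀⟩⟩ := isEmpty_or_nonempty C
  · exact ⟨0, fun a => hC0.elim a⟩
  let H : C(I × C, B) := h.comp
    ⟨fun p => ⟨AffineMap.lineMap (a₀ : V) (p.2 : V) (p.1 : ℝ),
      hC.segment_subset a₀.2 p.2.2 (by
        rw [segment_eq_image_lineMap]
        exact Set.mem_image_of_mem _ p.1.2)⟩, by
      refine Continuous.subtype_mk ?_ _
      simp only [AffineMap.lineMap_apply_module]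
      fun_prop⟩
  have hH0 (a : C) : H (0, a) = h a₀ := congrArg h (Subtype.ext (by simp))
  have hH1 (a : C) : H (1, a) = h a := congrArg h (Subtype.ext (by simp))
  let e₀ : Z.TotalSpace := ⟨h a₀, (0 : R)⟩
  let L : C(C, Z.TotalSpace) :=
    (cov.liftHomotopy H (.const C e₀) hH0).comp ⟨fun a => (1, a), by fun_prop⟩
  have hL (a : C) : (L a).1 = h a :=
    (congrFun (cov.liftHomotopy_lifts H (.const C e₀) hH0) (1, a)).trans (hH1 a)
  let q (a : C) : R := (L a).2
  refine ⟨fun a => q a + F (h a) (h a), fun a => ?_⟩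
  have hcont : ContinuousAt (fun b => (Z.localTriv (h a) (L b)).2) a := by
    refine continuousAt_snd.comp (ContinuousAt.comp (f := L) ?_ L.continuous.continuousAt)
    refine (Z.localTriv (h a)).continuousAt ?_
    rw [Bundle.Trivialization.mem_source]
    change (L a).1 ∈ W (h a)
    rw [hL]
    exact hW _
  rw [ContinuousAt, nhds_discrete R, Filter.tendsto_pure] at hcont
  filter_upwards [hcont] with b hb
  change q b + F (L b).1 (L b).1 - F (h a) (L b).1 =
    q a + F (L a).1 (L a).1 - F (h a) (L a).1 at hb
  rw [hL, hL] at hb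
  rw [sub_eq_sub_iff_sub_eq_sub]
  exact hb

end LocalPrimitive

section ConvexSimplex

variable {V : Type*} [NormedAddCommGroup V] [NormedSpace ℝ V] {C : Set V} (hC : Convex ℝ C)

/-- The affine simplex with given vertices in a convex set. -/
def convexSimplex {k : ℕ} (v : Fin k → C) : C(stdSimplex ℝ (Fin k), C) where
  toFun p := ⟨∑ i, p i • (v i : V),
    hC.sum_mem (fun i _ => p.2.1 i) p.2.2 fun i _ => (v i).2⟩
  continuous_toFun := by
    refine Continuous.subtype_mk (continuous_finsetSum _ fun i _ => ?_) _
    exact ((continuous_apply i).comp continuous_subtype_val).smul continuous_const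

theorem coe_convexSimplex {k : ℕ} (v : Fin k → C) (p : stdSimplex ℝ (Fin k)) :
    (convexSimplex hC v p : V) = ∑ i, p i • (v i : V) := rfl

theorem coe_convexSimplex_pair (a b : C) (p : stdSimplex ℝ (Fin 2)) :
    (convexSimplex hC ![a, b] p : V) = p 0 • (a : V) + p 1 • (b : V) :=
  (coe_convexSimplex hC _ p).trans (Fin.sum_univ_two fun i => p i • ((![a, b] i : C) : V))

theorem convexSimplex_comp_simplexFace {k : ℕ} (v : Fin (k + 2) → C) (i : Fin (k + 2)) :
    (convexSimplex hC v).comp (simplexFace i) = convexSimplex hC (v ∘ i.succAbove) := by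
  ext p
  change ∑ j, FunOnFinite.linearMap ℝ ℝ i.succAbove p j • (v j : V) =
    ∑ j, p j • (v (i.succAbove j) : V)
  simp only [FunOnFinite.linearMap_apply_apply, Finset.sum_smul]
  rw [← Finset.sum_fiberwise Finset.univ i.succAbove (fun j => p j • (v (i.succAbove j) : V))]
  refine Finset.sum_congr rfl fun j _ => Finset.sum_congr rfl fun l hl => ?_
  rw [(Finset.mem_filter.1 hl).2]

theorem simplexFace_vertex {k : ℕ} (i : Fin (k + 2)) (j : Fin (k + 1)) :
    simplexFace i (stdSimplex.vertex j) = stdSimplex.vertex (i.succAbove j) :=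
  stdSimplex.map_vertex _ _

theorem simplexFace_vertices_alternating_sum (G : stdSimplex ℝ (Fin 3) → ℚ) :
    G (simplexFace 0 (stdSimplex.vertex 1)) - G (simplexFace 0 (stdSimplex.vertex 0)) -
      (G (simplexFace 1 (stdSimplex.vertex 1)) - G (simplexFace 1 (stdSimplex.vertex 0))) +
      (G (simplexFace 2 (stdSimplex.vertex 1)) - G (simplexFace 2 (stdSimplex.vertex 0))) = 0 := by
  have h0 : (0 : Fin 3).succAbove (0 : Fin 2) = 1 := rfl
  have h1 : (0 : Fin 3).succAbove (1 : Fin 2) = 2 := rfl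
  have h2 : (1 : Fin 3).succAbove (0 : Fin 2) = 0 := rfl
  have h3 : (1 : Fin 3).succAbove (1 : Fin 2) = 2 := rfl
  have h4 : (2 : Fin 3).succAbove (0 : Fin 2) = 0 := rfl
  have h5 : (2 : Fin 3).succAbove (1 : Fin 2) = 1 := rfl
  simp only [simplexFace_vertex, h0, h1, h2, h3, h4, h5]
  ring

theorem coboundary_mem_singularCocycles {X : Type} [TopologicalSpace X] (g : X → ℚ) :
    (fun γ : C(stdSimplex ℝ (Fin 2), X) =>
      g (γ (stdSimplex.vertex 1)) - g (γ (stdSimplex.vertex 0))) ∈ singularCocycles X :=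
  fun σ => simplexFace_vertices_alternating_sum (g ∘ σ)

theorem convexSimplex_vertex {k : ℕ} (v : Fin k → C) (i : Fin k) :
    convexSimplex hC v (stdSimplex.vertex i) = v i := by
  ext
  rw [coe_convexSimplex, Finset.sum_eq_single i] <;> simp +contextual

theorem convexSimplex_stdSimplex_vertex (k : ℕ) :
    convexSimplex (convex_stdSimplex ℝ (Fin k)) stdSimplex.vertex = ContinuousMap.id _ := by
  refine ContinuousMap.ext fun p => Subtype.ext (funext fun i => ?_)
  rw [coe_convexSimplex]
  simp [Finset.sum_apply, Pi.single_apply]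
  rfl

theorem singularCocycles_edge_add {X : Type} [TopologicalSpace X]
    {c : C(stdSimplex ℝ (Fin 2), X) → ℚ} (hc : c ∈ singularCocycles X) (h : C(C, X)) (a b d : C) :
    c (h.comp (convexSimplex hC ![a, b])) + c (h.comp (convexSimplex hC ![b, d])) =
      c (h.comp (convexSimplex hC ![a, d])) := by
  have := hc (h.comp (convexSimplex hC ![a, b, d]))
  simp only [ContinuousMap.comp_assoc, convexSimplex_comp_simplexFace] at this
  have h0 : ![a, b, d] ∘ Fin.succAbove 0 = ![b, d] := by ext i; fin_cases i <;> rfl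
  have h1 : ![a, b, d] ∘ Fin.succAbove 1 = ![a, d] := by ext i; fin_cases i <;> rfl
  have h2 : ![a, b, d] ∘ Fin.succAbove 2 = ![a, b] := by ext i; fin_cases i <;> rfl
  rw [h0, h1, h2] at this
  linarith

end ConvexSimplex

section StarCover

variable {E : Type} [NormedAddCommGroup E] [NormedSpace ℝ E]

/-- The affine 1-simplex joining two points of `B` whose segment lies in `B`. -/
def segmentSimplex {B : Set E} {x y : E} (h : segment ℝ x y ⊆ B) : C(stdSimplex ℝ (Fin 2), B) :=
  ContinuousMap.comp ⟨Set.inclusion h, continuous_inclusion h⟩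
    (convexSimplex (convex_segment x y)
      ![⟨x, left_mem_segment ℝ x y⟩, ⟨y, right_mem_segment ℝ x y⟩])

theorem segmentSimplex_mem {B : Set E} {x y : E} (h : segment ℝ x y ⊆ B) (p) :
    (segmentSimplex h p : E) ∈ segment ℝ x y :=
  (convexSimplex (convex_segment x y) _ p).2

theorem segmentSimplex_vertex_zero {B : Set E} {x y : E} (h : segment ℝ x y ⊆ B) :
    segmentSimplex h (stdSimplex.vertex 0) = ⟨x, h (left_mem_segment ℝ x y)⟩ :=
  congrArg (Set.inclusion h) (convexSimplex_vertex _ _ 0)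

theorem segmentSimplex_vertex_one {B : Set E} {x y : E} (h : segment ℝ x y ⊆ B) :
    segmentSimplex h (stdSimplex.vertex 1) = ⟨y, h (right_mem_segment ℝ x y)⟩ :=
  congrArg (Set.inclusion h) (convexSimplex_vertex _ _ 1)

theorem locallyConstant_apply_eq_of_simplex {X : Type*} [TopologicalSpace X]
    (g : LocallyConstant X ℚ) (γ : C(stdSimplex ℝ (Fin 2), X)) (p q) : g (γ p) = g (γ q) :=
  (g.isLocallyConstant.comp_continuous γ.continuous).apply_eq_of_preconnectedSpace p q

theorem locallyConstant_apply_eq_of_segment {B : Set E} (g : LocallyConstant B ℚ) {x y : E}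
    (h : segment ℝ x y ⊆ B) :
    g ⟨x, h (left_mem_segment ℝ x y)⟩ = g ⟨y, h (right_mem_segment ℝ x y)⟩ := by
  rw [← segmentSimplex_vertex_zero h, ← segmentSimplex_vertex_one h]
  exact locallyConstant_apply_eq_of_simplex g _ _ _

/-- A cover of `A` by sets `S i` such that every point `x` of `A` has an open neighbourhood in which
each `S i` is star-shaped around `x`, in the sense that it contains the segments from its points
to `x`. -/
structure StarCover {n : ℕ} (A : Set E) (S : Fin n → Set E) where
  cover : A = ⋃ i, S i
  nhd : E → Set E
  isOpen_nhd : ∀ x, IsOpen (nhd x)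
  mem_nhd : ∀ x ∈ A, x ∈ nhd x
  segment_subset : ∀ x ∈ A, ∀ y ∈ nhd x, ∀ i, y ∈ S i → segment ℝ x y ⊆ S i

namespace StarCover

variable {n : ℕ} {A : Set E} {S : Fin n → Set E} (U : StarCover A S)

theorem subset (U : StarCover A S) (i : Fin n) : S i ⊆ A := U.cover ▸ Set.subset_iUnion S i

theorem exists_mem (U : StarCover A S) (x : A) : ∃ i, (x : E) ∈ S i :=
  Set.mem_iUnion.1 (U.cover ▸ x.2)

theorem segment_subset_of_mem_nhd (x : A) {y : E} (hy : y ∈ U.nhd x) (hyA : y ∈ A) :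
    segment ℝ (x : E) y ⊆ A := by
  obtain ⟨i, hi⟩ := U.exists_mem ⟨y, hyA⟩
  exact (U.segment_subset x x.2 y hy i hi).trans (U.subset i)

theorem mem_of_mem_nhd (x : A) {y : E} (hy : y ∈ U.nhd x) {i : Fin n} (hi : y ∈ S i) :
    (x : E) ∈ S i :=
  U.segment_subset x x.2 y hy i hi (left_mem_segment ℝ _ _)

theorem eventually_nhd {Y : Type*} [TopologicalSpace Y] (h : C(Y, A)) (a : Y) :
    ∀ᶠ b in nhds a, (h b : E) ∈ U.nhd (h a) :=
  (continuous_subtype_val.comp h.continuous).continuousAt.eventually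
    ((U.isOpen_nhd _).mem_nhds (U.mem_nhd _ (h a).2))

theorem cocycle_edge_eq_zero {c : C(stdSimplex ℝ (Fin 2), A) → ℚ}
    (hc : c ∈ singularCocycles A)
    (hc0 : ∀ γ, (∃ i, ∀ p, (γ p : E) ∈ S i) → c γ = 0)
    {V : Type*} [NormedAddCommGroup V] [NormedSpace ℝ V] {C : Set V}
    (hC : Convex ℝ C) (γ : C(C, A)) (a b : C) (hγ : ∀ p, (γ p : E) ∈ U.nhd (γ a)) :
    c (γ.comp (convexSimplex hC ![a, b])) = 0 := by
  have hD : Convex ℝ (Set.Icc (0 : ℝ) 1 ×ˢ C) := (convex_Icc 0 1).prod hC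
  have hseg (p : ↥(Set.Icc (0 : ℝ) 1 ×ˢ C)) :
      AffineMap.lineMap (γ a : E) (γ ⟨p.1.2, p.2.2⟩ : E) p.1.1 ∈
        segment ℝ (γ a : E) (γ ⟨p.1.2, p.2.2⟩ : E) := by
    rw [segment_eq_image_lineMap]
    exact Set.mem_image_of_mem _ p.2.1
  let H : C(↥(Set.Icc (0 : ℝ) 1 ×ˢ C), A) :=
    { toFun := fun p => ⟨AffineMap.lineMap (γ a : E) (γ ⟨p.1.2, p.2.2⟩ : E) p.1.1,
        U.segment_subset_of_mem_nhd _ (hγ _) (γ _).2 (hseg p)⟩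
      continuous_toFun := by
        refine Continuous.subtype_mk ?_ _
        simp only [AffineMap.lineMap_apply_module]
        fun_prop }
  let pt (t : Set.Icc (0 : ℝ) 1) (u : C) : ↥(Set.Icc (0 : ℝ) 1 ×ˢ C) := ⟨(t, u), t.2, u.2⟩
  have hH (q : ↥(Set.Icc (0 : ℝ) 1 ×ˢ C)) {t : ℝ} {u : C} (ht : q.1.1 = t) (hu : q.1.2 = u) :
      (H q : E) = AffineMap.lineMap (γ a : E) (γ u : E) t := by
    obtain rfl : u = ⟨q.1.2, q.2.2⟩ := Subtype.ext hu.symm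
    subst ht
    rfl
  have hvert (s t : Set.Icc (0 : ℝ) 1) (u : C) :
      c (H.comp (convexSimplex hD ![pt s u, pt t u])) = 0 := by
    obtain ⟨i, hi⟩ := U.exists_mem (γ u)
    refine hc0 _ ⟨i, fun p => U.segment_subset _ (γ a).2 _ (hγ u) i hi ?_⟩
    have h2 : (convexSimplex hD ![pt s u, pt t u] p).1.2 = u := by
      simp [coe_convexSimplex, Fin.sum_univ_two, pt, ← add_smul, stdSimplex.add_eq_one]
    rw [ContinuousMap.comp_apply, hH _ rfl h2, segment_eq_image_lineMap]
    exact Set.mem_image_of_mem _ (convexSimplex hD ![pt s u, pt t u] p).2.1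
  have hbase : c (H.comp (convexSimplex hD ![pt 0 a, pt 0 b])) = 0 := by
    obtain ⟨i, hi⟩ := U.exists_mem (γ a)
    refine hc0 _ ⟨i, fun p => ?_⟩
    have h1 : (convexSimplex hD ![pt 0 a, pt 0 b] p).1.1 = 0 := by
      simp [coe_convexSimplex, Fin.sum_univ_two, pt]
    rw [ContinuousMap.comp_apply,
      hH _ (u := ⟨_, (convexSimplex hD ![pt 0 a, pt 0 b] p).2.2⟩) h1 rfl,
      AffineMap.lineMap_apply_zero]
    exact hi
  have htop : γ.comp (convexSimplex hC ![a, b]) =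
      H.comp (convexSimplex hD ![pt 1 a, pt 1 b]) := by
    refine ContinuousMap.ext fun p => Subtype.ext ?_
    have h1 : (convexSimplex hD ![pt 1 a, pt 1 b] p).1.1 = 1 := by
      simp [coe_convexSimplex, Fin.sum_univ_two, pt, stdSimplex.add_eq_one]
    have h2 : (convexSimplex hD ![pt 1 a, pt 1 b] p).1.2 = convexSimplex hC ![a, b] p := by
      simp [coe_convexSimplex, Fin.sum_univ_two, pt]
    rw [ContinuousMap.comp_apply, ContinuousMap.comp_apply, hH _ h1 h2,
      AffineMap.lineMap_apply_one]
  rw [htop, ← singularCocycles_edge_add hD hc H _ (pt 0 a) _,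
    ← singularCocycles_edge_add hD hc H (pt 0 a) (pt 0 b) _, hvert, hbase, hvert]
  simp

/-- A cocycle that vanishes on the simplices subordinate to a star cover is zero. -/
theorem cocycle_eq_zero (U : StarCover A S) {c : C(stdSimplex ℝ (Fin 2), A) → ℚ}
    (hc : c ∈ singularCocycles A)
    (hc0 : ∀ γ, (∃ i, ∀ p, (γ p : E) ∈ S i) → c γ = 0)
    (γ : C(stdSimplex ℝ (Fin 2), A)) : c γ = 0 := by
  have hC := convex_stdSimplex ℝ (Fin 2)
  let D (a b : stdSimplex ℝ (Fin 2)) := c (γ.comp (convexSimplex hC ![a, b]))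
  have hD (a b d) : D a b + D b d = D a d := singularCocycles_edge_add hC hc γ a b d
  have hloc : IsLocallyConstant (D (stdSimplex.vertex 0)) := by
    rw [IsLocallyConstant.iff_eventually_eq]
    intro b
    obtain ⟨ε, hε, hball⟩ := Metric.eventually_nhds_iff_ball.1 (U.eventually_nhd γ b)
    rw [Metric.eventually_nhds_iff_ball]
    refine ⟨ε, hε, fun b' hb' => ?_⟩
    have hC' : Convex ℝ (stdSimplex ℝ (Fin 2) ∩ Metric.ball (b : Fin 2 → ℝ) ε) :=
      hC.inter (convex_ball _ _)
    have h0 := U.cocycle_edge_eq_zero hc hc0 hC'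
      (γ.comp ⟨Set.inclusion Set.inter_subset_left, continuous_inclusion _⟩)
      ⟨b, b.2, Metric.mem_ball_self hε⟩ ⟨b', b'.2, hb'⟩ (fun p => hball ⟨p.1, p.2.1⟩ p.2.2)
    have h1 : D b b' = 0 := by
      rw [← h0, ContinuousMap.comp_assoc]
      refine congrArg (fun δ => c (γ.comp δ)) (ContinuousMap.ext fun p => Subtype.ext ?_)
      change (convexSimplex hC ![b, b'] p : Fin 2 → ℝ) =
        (convexSimplex hC' ![⟨b, b.2, Metric.mem_ball_self hε⟩, ⟨b', b'.2, hb'⟩] p).1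
      exact (coe_convexSimplex_pair hC b b' p).trans (coe_convexSimplex_pair hC'
        ⟨b, b.2, Metric.mem_ball_self hε⟩ ⟨b', b'.2, hb'⟩ p).symm
    rw [← hD _ b b', h1, add_zero]
  have h00 : D (stdSimplex.vertex 0) (stdSimplex.vertex 0) = 0 := by
    linarith [hD (stdSimplex.vertex 0) (stdSimplex.vertex 0) (stdSimplex.vertex 0)]
  have h01 := hloc.apply_eq_of_preconnectedSpace (stdSimplex.vertex 0) (stdSimplex.vertex 1)
  have hv : ![stdSimplex.vertex 0, stdSimplex.vertex 1] =
      (stdSimplex.vertex : Fin 2 → stdSimplex ℝ (Fin 2)) := by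
    ext i
    fin_cases i <;> rfl
  rw [h00] at h01
  rw [h01]
  change c γ = c (γ.comp (convexSimplex hC ![stdSimplex.vertex 0, stdSimplex.vertex 1]))
  rw [hv, convexSimplex_stdSimplex_vertex, ContinuousMap.comp_id]

section Primitive

variable (S) in
/-- `G` has the same local increments along `h` as those functions `f i` for which they are
defined. -/
def IsPrimitive (f : Fin n → A → ℚ) {Y : Type*} [TopologicalSpace Y] (h : C(Y, A)) (G : Y → ℚ) :
    Prop :=
  ∀ a, ∀ᶠ b in nhds a, ∀ i, (h b : E) ∈ S i → G b - G a = f i (h b) - f i (h a)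

variable {f : Fin n → A → ℚ}

theorem isPrimitive_of_mem {Y : Type*} [TopologicalSpace Y] {h : C(Y, A)} {i : Fin n}
    (hf : ∀ i j, ∀ x y : A, (y : E) ∈ U.nhd x → (y : E) ∈ S i → (y : E) ∈ S j →
      f j y - f i y = f j x - f i x) (hi : ∀ a, (h a : E) ∈ S i) :
    IsPrimitive S f h (f i ∘ h) := by
  intro a
  filter_upwards [U.eventually_nhd h a] with b hb j hj
  have := hf i j _ _ hb (hi b) hj
  simp only [Function.comp_apply]
  linarith

theorem IsPrimitive.sub_eq_sub (U : StarCover A S) {Y : Type*} [TopologicalSpace Y] [PreconnectedSpace Y]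
    {h : C(Y, A)}
    {G G' : Y → ℚ} (hG : IsPrimitive S f h G) (hG' : IsPrimitive S f h G') (a b : Y) :
    G b - G a = G' b - G' a := by
  have hloc : IsLocallyConstant (G - G') := by
    rw [IsLocallyConstant.iff_eventually_eq]
    intro a
    filter_upwards [hG a, hG' a] with b hb hb'
    obtain ⟨i, hi⟩ := U.exists_mem (h b)
    simp only [Pi.sub_apply]
    linarith [hb i hi, hb' i hi]
  have := hloc.apply_eq_of_preconnectedSpace a b
  simp only [Pi.sub_apply] at this
  linarith

theorem exists_isPrimitive
    (hf : ∀ i j, ∀ x y : A, (y : E) ∈ U.nhd x → (y : E) ∈ S i → (y : E) ∈ S j →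
      f j y - f i y = f j x - f i x)
    {V : Type*} [NormedAddCommGroup V] [NormedSpace ℝ V] {C : Set V} (hC : Convex ℝ C)
    (h : C(C, A)) : ∃ G, IsPrimitive S f h G := by
  choose ι hι using U.exists_mem
  let F (x y : A) : ℚ := f (ι y) y - f (ι y) x
  have hF (i) (x y : A) (hxy : (y : E) ∈ U.nhd x) (hi : (y : E) ∈ S i) :
      F x y = f i y - f i x := by
    have := hf i (ι y) x y hxy hi (hι y)
    simp only [F]
    linarith
  have hmem (x : A) : (x : E) ∈ U.nhd x := U.mem_nhd x x.2
  have hWo (x : A) : IsOpen (Subtype.val ⁻¹' U.nhd x : Set A) :=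
    (U.isOpen_nhd x).preimage continuous_subtype_val
  obtain ⟨G, hG⟩ := exists_local_primitive
    (fun x : A => (Subtype.val ⁻¹' U.nhd (x : E) : Set A)) F hWo hmem (fun x y z hz => by
      filter_upwards [(hWo z).mem_nhds (hmem z), (hWo x).mem_nhds hz.1, (hWo y).mem_nhds hz.2]
        with w hwz hwx hwy
      have hi := U.mem_of_mem_nhd z hwz (hι w)
      rw [hF (ι w) x w hwx (hι w), hF (ι w) y w hwy (hι w), hF (ι w) x z hz.1 hi,
        hF (ι w) y z hz.2 hi]
      ring) hC h
  refine ⟨G, fun a => ?_⟩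
  filter_upwards [hG a, U.eventually_nhd h a] with b hb hab i hi
  rw [hb, hF i _ _ hab hi, hF _ _ _ (hmem _) (hι _)]
  ring

theorem exists_cocycle
    (hf : ∀ i j, ∀ x y : A, (y : E) ∈ U.nhd x → (y : E) ∈ S i → (y : E) ∈ S j →
      f j y - f i y = f j x - f i x) :
    ∃ c ∈ singularCocycles A, ∀ i γ, (∀ p, (γ p : E) ∈ S i) →
      c γ = f i (γ (stdSimplex.vertex 1)) - f i (γ (stdSimplex.vertex 0)) := by
  choose G hG using fun {k : ℕ} => U.exists_isPrimitive hf (convex_stdSimplex ℝ (Fin k))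
  let c (γ : C(stdSimplex ℝ (Fin 2), A)) : ℚ :=
    G γ (stdSimplex.vertex 1) - G γ (stdSimplex.vertex 0)
  have hc {γ} {G'} (hG' : IsPrimitive S f γ G') :
      c γ = G' (stdSimplex.vertex 1) - G' (stdSimplex.vertex 0) :=
    IsPrimitive.sub_eq_sub U (hG γ) hG' _ _
  have hface (σ : C(stdSimplex ℝ (Fin 3), A)) (i : Fin 3) :
      IsPrimitive S f (σ.comp (simplexFace i)) (G σ ∘ simplexFace i) :=
    fun a => (simplexFace i).continuous.continuousAt.eventually (hG σ (simplexFace i a))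
  refine ⟨c, fun σ => ?_, fun i γ hγ => hc (U.isPrimitive_of_mem hf hγ)⟩
  rw [hc (hface σ 0), hc (hface σ 1),
    hc (hface σ 2)]
  exact simplexFace_vertices_alternating_sum (G σ)

end Primitive

theorem isLocallyConstant_of_segment {B : Set E} (hBA : B ⊆ A)
    (hB : ∀ x ∈ B, ∀ y ∈ B, y ∈ U.nhd x → segment ℝ x y ⊆ B) {g : B → ℚ}
    (hg : ∀ x y : B, segment ℝ (x : E) y ⊆ B → g y = g x) : IsLocallyConstant g := by
  rw [IsLocallyConstant.iff_eventually_eq]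
  intro x
  filter_upwards [((U.isOpen_nhd x).preimage continuous_subtype_val).mem_nhds
    (U.mem_nhd x (hBA x.2))] with y hy
  exact hg x y (hB x x.2 y y.2 hy)

theorem finite_locallyConstant {B : Set E} (hBA : B ⊆ A)
    (hB : ∀ x ∈ B, ∀ y ∈ B, y ∈ U.nhd x → segment ℝ x y ⊆ B) (hc : IsCompact B) :
    Module.Finite ℚ (LocallyConstant B ℚ) := by
  obtain ⟨t, htB, ht⟩ := hc.elim_nhds_subcover U.nhd fun x hx =>
    (U.isOpen_nhd x).mem_nhds (U.mem_nhd x (hBA hx))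
  let ev : LocallyConstant B ℚ →ₗ[ℚ] (t → ℚ) :=
    { toFun := fun g x => g ⟨x, htB x x.2⟩
      map_add' := fun _ _ => rfl
      map_smul' := fun _ _ => rfl }
  refine Module.Finite.of_injective ev fun g g' hgg' => LocallyConstant.ext fun y => ?_
  obtain ⟨x, hx, hy⟩ := Set.mem_iUnion₂.1 (ht y.2)
  have hseg := hB x (htB x hx) y y.2 hy
  have h1 := locallyConstant_apply_eq_of_segment g hseg
  have h2 := locallyConstant_apply_eq_of_segment g' hseg
  exact h1.symm.trans ((congrFun hgg' ⟨x, hx⟩).trans h2)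

theorem segment_subset_inter (i j : Fin n) : ∀ x ∈ S i ∩ S j, ∀ y ∈ S i ∩ S j, y ∈ U.nhd x →
    segment ℝ x y ⊆ S i ∩ S j := fun x hx y hy hxy =>
  Set.subset_inter (U.segment_subset x (U.subset i hx.1) y hxy i hy.1)
    (U.segment_subset x (U.subset i hx.1) y hxy j hy.2)

/-- A cocycle is a coboundary over the members of the cover with vanishing first homology. -/
theorem exists_eq_coboundary_of_subsingleton (U : StarCover A S) {i : Fin n}
    (hi : Subsingleton (singularHomologyQ (S i) 1)) {c : C(stdSimplex ℝ (Fin 2), A) → ℚ}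
    (hc : c ∈ singularCocycles A) :
    ∃ g : A → ℚ, ∀ γ : C(stdSimplex ℝ (Fin 2), A), (∀ p, (γ p : E) ∈ S i) →
      c γ = g (γ (stdSimplex.vertex 1)) - g (γ (stdSimplex.vertex 0)) := by
  classical
  obtain ⟨Φ, -, hΦ⟩ := exists_dual_singularHomology_one (S i)
  let ι : C(S i, A) := ⟨Set.inclusion (U.subset i), continuous_inclusion _⟩
  let ci : singularCocycles (S i) := ⟨fun γ => c (ι.comp γ), fun σ => hc (ι.comp σ)⟩
  obtain ⟨g, hg⟩ := (hΦ ci).1 (LinearMap.ext fun z => by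
    rw [Subsingleton.elim z 0, map_zero, map_zero])
  refine ⟨fun x => if hx : (x : E) ∈ S i then g ⟨x, hx⟩ else 0, fun γ hγ => ?_⟩
  dsimp only
  rw [dif_pos (hγ _), dif_pos (hγ _)]
  exact hg ⟨fun p => ⟨γ p, hγ p⟩, (continuous_subtype_val.comp γ.continuous).subtype_mk _⟩

theorem eq_sub_of_segment (U : StarCover A S) {B : Set E} {i : Fin n} (hBi : B ⊆ S i)
    {c : C(stdSimplex ℝ (Fin 2), A) → ℚ} {g : A → ℚ}
    (hg : ∀ γ : C(stdSimplex ℝ (Fin 2), A), (∀ p, (γ p : E) ∈ S i) →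
      c γ = g (γ (stdSimplex.vertex 1)) - g (γ (stdSimplex.vertex 0)))
    {x y : A} (h : segment ℝ (x : E) y ⊆ B) :
    c (segmentSimplex (h.trans (hBi.trans (U.subset i)))) = g y - g x := by
  rw [hg _ fun p => hBi (h (segmentSimplex_mem _ p)), segmentSimplex_vertex_zero,
    segmentSimplex_vertex_one]

/-- A 1-cocycle of the nerve with locally constant values is the coboundary of a family of (not
necessarily continuous) functions. -/
theorem exists_eq_sub (U : StarCover A S)
    (ψ : ∀ p : PairIdx n, LocallyConstant ↥(S p.1.1 ∩ S p.1.2) ℚ)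
    (hψ : ∀ q : TripleIdx n, ∀ x (hx : x ∈ (S q.1.1 ∩ S q.1.2.1) ∩ S q.1.2.2),
      ψ ⟨(q.1.2.1, q.1.2.2), q.2.2⟩ ⟨x, hx.1.2, hx.2⟩ -
        ψ ⟨(q.1.1, q.1.2.2), lt_trans q.2.1 q.2.2⟩ ⟨x, hx.1.1, hx.2⟩ +
        ψ ⟨(q.1.1, q.1.2.1), q.2.1⟩ ⟨x, hx.1⟩ = 0) :
    ∃ f : Fin n → A → ℚ, ∀ p, ∀ x : A, ∀ hx, ψ p ⟨x, hx⟩ = f p.1.2 x - f p.1.1 x := by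
  classical
  let e (i j : Fin n) (x : E) : ℚ :=
    if h : i < j ∧ x ∈ S i ∩ S j then ψ ⟨(i, j), h.1⟩ ⟨x, h.2⟩
    else if h : j < i ∧ x ∈ S j ∩ S i then -ψ ⟨(j, i), h.1⟩ ⟨x, h.2⟩ else 0
  have he {i j : Fin n} (hij : i < j) {x : E} (hx : x ∈ S i ∩ S j) :
      e i j x = ψ ⟨(i, j), hij⟩ ⟨x, hx⟩ := dif_pos ⟨hij, hx⟩
  have hself (i : Fin n) (x : E) : e i i x = 0 := by simp [e]
  have hanti {i j : Fin n} (hij : i < j) {x : E} (hx : x ∈ S i ∩ S j) :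
      e j i x = -e i j x := by
    rw [he hij hx]
    exact (dif_neg fun h => h.1.not_gt hij).trans (dif_pos ⟨hij, hx⟩)
  have hlt {i j l : Fin n} (hij : i < j) (hjl : j < l) {x : E} (hi : x ∈ S i) (hj : x ∈ S j)
      (hl : x ∈ S l) : e j l x - e i l x + e i j x = 0 := by
    rw [he hjl ⟨hj, hl⟩, he (hij.trans hjl) ⟨hi, hl⟩, he hij ⟨hi, hj⟩]
    exact hψ ⟨(i, j, l), hij, hjl⟩ x ⟨⟨hi, hj⟩, hl⟩
  have hcoc (i : Fin n) {j l : Fin n} (hjl : j < l) {x : E} (hi : x ∈ S i) (hj : x ∈ S j)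
      (hl : x ∈ S l) : e j l x = e i l x - e i j x := by
    obtain hij | rfl | hij := lt_trichotomy i j
    · linarith [hlt hij hjl hi hj hl]
    · linarith [hself i x]
    · have h1 := hanti hij ⟨hj, hi⟩
      obtain hil | rfl | hil := lt_trichotomy i l
      · linarith [hlt hij hil hj hi hl]
      · linarith [hself i x]
      · linarith [hlt hjl hil hj hl hi, hanti hil ⟨hl, hi⟩]
  choose ι hι using U.exists_mem
  exact ⟨fun j x => e (ι x) j x, fun p x hx => by
    rw [← hcoc (ι x) p.2 (hι x) hx.1 hx.2, he p.2 hx]⟩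

variable (A S) in
/-- Triples of a singular cocycle, local primitives of it over the cover, and the differences of
these local primitives. -/
def primitiveTriples : Submodule ℚ ((C(stdSimplex ℝ (Fin 2), A) → ℚ) × (Fin n → A → ℚ) ×
    ∀ p : PairIdx n, LocallyConstant ↥(S p.1.1 ∩ S p.1.2) ℚ) where
  carrier := {t | t.1 ∈ singularCocycles A ∧
    (∀ i, ∀ γ : C(stdSimplex ℝ (Fin 2), A), (∀ p, (γ p : E) ∈ S i) →
      t.1 γ = t.2.1 i (γ (stdSimplex.vertex 1)) - t.2.1 i (γ (stdSimplex.vertex 0))) ∧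
    ∀ p, ∀ x : A, ∀ hx, t.2.2 p ⟨x, hx⟩ = t.2.1 p.1.2 x - t.2.1 p.1.1 x}
  zero_mem' := ⟨zero_mem _, fun _ _ _ => by simp, fun _ _ _ => by simp⟩
  add_mem' := fun {a b} ha hb => ⟨add_mem ha.1 hb.1,
    fun i γ hγ => by
      have h1 := ha.2.1 i γ hγ
      have h2 := hb.2.1 i γ hγ
      simp only [Prod.fst_add, Prod.snd_add, Pi.add_apply]
      linarith,
    fun p x hx => by
      have h1 := ha.2.2 p x hx
      have h2 := hb.2.2 p x hx
      simp only [Prod.snd_add, Prod.fst_add, Pi.add_apply, LocallyConstant.add_apply]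
      linarith⟩
  smul_mem' := fun r a ha => ⟨Submodule.smul_mem _ r ha.1,
    fun i γ hγ => by
      have h1 := ha.2.1 i γ hγ
      simp only [Prod.smul_fst, Prod.smul_snd, Pi.smul_apply, h1, smul_sub],
    fun p x hx => by
      have h1 := ha.2.2 p x hx
      simp only [Prod.smul_fst, Prod.smul_snd, Pi.smul_apply, LocallyConstant.smul_apply, h1,
        smul_sub]⟩

theorem exists_primitiveTriples_of_cocycle (U : StarCover A S)
    (hS : ∀ i, Subsingleton (singularHomologyQ (S i) 1))
    {c : C(stdSimplex ℝ (Fin 2), A) → ℚ} (hc : c ∈ singularCocycles A) :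
    ∃ t ∈ primitiveTriples A S, t.1 = c := by
  choose f hf using fun i => U.exists_eq_coboundary_of_subsingleton (hS i) hc
  let ψ (p : PairIdx n) : LocallyConstant ↥(S p.1.1 ∩ S p.1.2) ℚ :=
    ⟨fun x => f p.1.2 ⟨x, U.subset _ x.2.2⟩ - f p.1.1 ⟨x, U.subset _ x.2.2⟩,
      U.isLocallyConstant_of_segment (Set.inter_subset_left.trans (U.subset _))
        (U.segment_subset_inter _ _) fun x y h => by
          have h1 := U.eq_sub_of_segment Set.inter_subset_left (hf p.1.1)
            (x := ⟨x, U.subset _ x.2.2⟩) (y := ⟨y, U.subset _ y.2.2⟩) h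
          have h2 := U.eq_sub_of_segment Set.inter_subset_right (hf p.1.2)
            (x := ⟨x, U.subset _ x.2.2⟩) (y := ⟨y, U.subset _ y.2.2⟩) h
          linarith⟩
  exact ⟨(c, f, ψ), ⟨hc, hf, fun p x hx => rfl⟩, rfl⟩

theorem exists_primitiveTriples_of_nerve_cocycle (U : StarCover A S)
    (ψ : ∀ p : PairIdx n, LocallyConstant ↥(S p.1.1 ∩ S p.1.2) ℚ)
    (hψ : ∀ q : TripleIdx n, ∀ x (hx : x ∈ (S q.1.1 ∩ S q.1.2.1) ∩ S q.1.2.2),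
      ψ ⟨(q.1.2.1, q.1.2.2), q.2.2⟩ ⟨x, hx.1.2, hx.2⟩ -
        ψ ⟨(q.1.1, q.1.2.2), lt_trans q.2.1 q.2.2⟩ ⟨x, hx.1.1, hx.2⟩ +
        ψ ⟨(q.1.1, q.1.2.1), q.2.1⟩ ⟨x, hx.1⟩ = 0) :
    ∃ t ∈ primitiveTriples A S, t.2.2 = ψ := by
  obtain ⟨f, hf⟩ := U.exists_eq_sub ψ hψ
  have hlt {i j : Fin n} (hij : i < j) {x y : A} (hxy : (y : E) ∈ U.nhd x) (hi : (y : E) ∈ S i)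
      (hj : (y : E) ∈ S j) : f j y - f i y = f j x - f i x := by
    have hx : (x : E) ∈ S i ∩ S j := ⟨U.mem_of_mem_nhd x hxy hi, U.mem_of_mem_nhd x hxy hj⟩
    rw [← hf ⟨(i, j), hij⟩ y ⟨hi, hj⟩, ← hf ⟨(i, j), hij⟩ x hx]
    exact (locallyConstant_apply_eq_of_segment _
      (U.segment_subset_inter i j x hx y ⟨hi, hj⟩ hxy)).symm
  obtain ⟨c, hc, hcf⟩ := U.exists_cocycle (f := f) fun i j x y hxy hi hj => by
    obtain hij | rfl | hij := lt_trichotomy i j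
    · exact hlt hij hxy hi hj
    · simp
    · linarith [hlt hij hxy hj hi]
  exact ⟨(c, f, ψ), ⟨hc, hcf, hf⟩, rfl⟩

theorem isSingularCoboundary_iff_of_mem_primitiveTriples (U : StarCover A S)
    {t} (ht : t ∈ primitiveTriples A S) :
    IsSingularCoboundary t.1 ↔ ∃ φ : ∀ i, LocallyConstant (S i) ℚ,
      ∀ p : PairIdx n, ∀ x : ↥(S p.1.1 ∩ S p.1.2),
        φ p.1.2 ⟨x, x.2.2⟩ - φ p.1.1 ⟨x, x.2.1⟩ = t.2.2 p x := by
  obtain ⟨c, f, ψ⟩ := t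
  obtain ⟨hc, hf, hψ⟩ := ht
  dsimp only at hc hf hψ ⊢
  constructor
  · rintro ⟨g, hg⟩
    refine ⟨fun i => ⟨fun x => f i ⟨x, U.subset i x.2⟩ - g ⟨x, U.subset i x.2⟩,
      U.isLocallyConstant_of_segment (U.subset i)
        (fun x hx y hy hxy => U.segment_subset x (U.subset i hx) y hxy i hy)
        fun x y h => ?_⟩, fun p x => ?_⟩
    · have h1 := U.eq_sub_of_segment subset_rfl (hf i)
        (x := ⟨x, U.subset i x.2⟩) (y := ⟨y, U.subset i y.2⟩) h
      have h2 := U.eq_sub_of_segment (i := i) subset_rfl (fun γ _ => hg γ)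
        (x := ⟨x, U.subset i x.2⟩) (y := ⟨y, U.subset i y.2⟩) h
      linarith
    · have := hψ p ⟨x, U.subset _ x.2.1⟩ x.2
      refine Eq.trans ?_ this.symm
      change f _ _ - g _ - (f _ _ - g _) = _
      ring
  · rintro ⟨φ, hφ⟩
    choose ι hι using U.exists_mem
    let g (x : A) : ℚ := f (ι x) x - φ (ι x) ⟨x, hι x⟩
    have hlt {i j : Fin n} (hij : i < j) (x : A) (hi : (x : E) ∈ S i) (hj : (x : E) ∈ S j) :
        f i x - φ i ⟨x, hi⟩ = f j x - φ j ⟨x, hj⟩ := by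
      linarith [hφ ⟨(i, j), hij⟩ ⟨x, hi, hj⟩, hψ ⟨(i, j), hij⟩ x ⟨hi, hj⟩]
    have hg (i : Fin n) (x : A) (hi : (x : E) ∈ S i) : g x = f i x - φ i ⟨x, hi⟩ := by
      obtain h | h | h := lt_trichotomy (ι x) i
      · exact hlt h x _ _
      · subst h
        rfl
      · exact (hlt h x _ _).symm
    refine ⟨g, fun γ => sub_eq_zero.1 (U.cocycle_eq_zero
      (sub_mem hc (coboundary_mem_singularCocycles g)) ?_ γ)⟩
    rintro γ ⟨i, hi⟩
    have h1 := locallyConstant_apply_eq_of_simplex (φ i)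
      ⟨fun p => ⟨γ p, hi p⟩, (continuous_subtype_val.comp γ.continuous).subtype_mk _⟩
      (stdSimplex.vertex 0) (stdSimplex.vertex 1)
    have h2 := hf i γ hi
    have h3 := hg i _ (hi (stdSimplex.vertex 0))
    have h4 := hg i _ (hi (stdSimplex.vertex 1))
    simp only [Pi.sub_apply, h2, h3, h4]
    simp only [ContinuousMap.coe_mk] at h1
    linarith

/-- The first Betti number of a space with a star cover by sets with vanishing first homology. -/
theorem finrank_singularHomologyQ_one (U : StarCover A S)
    (hS : ∀ i, Subsingleton (singularHomologyQ (S i) 1))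
    (hcpt : ∀ i j, IsCompact (S i ∩ S j))
    (δ₁ : (∀ i, LocallyConstant (S i) ℚ) →ₗ[ℚ]
      ∀ p : PairIdx n, LocallyConstant ↥(S p.1.1 ∩ S p.1.2) ℚ)
    (hδ₁ : ∀ φ p x, δ₁ φ p x = φ p.1.2 ⟨x, x.2.2⟩ - φ p.1.1 ⟨x, x.2.1⟩)
    (δ₂ : (∀ p : PairIdx n, LocallyConstant ↥(S p.1.1 ∩ S p.1.2) ℚ) →ₗ[ℚ]
      ∀ q : TripleIdx n, LocallyConstant ↥((S q.1.1 ∩ S q.1.2.1) ∩ S q.1.2.2) ℚ)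
    (hδ₂ : ∀ ψ q x, δ₂ ψ q x = ψ ⟨(q.1.2.1, q.1.2.2), q.2.2⟩ ⟨x, x.2.1.2, x.2.2⟩ -
      ψ ⟨(q.1.1, q.1.2.2), lt_trans q.2.1 q.2.2⟩ ⟨x, x.2.1.1, x.2.2⟩ +
      ψ ⟨(q.1.1, q.1.2.1), q.2.1⟩ ⟨x, x.2.1⟩) :
    Module.finrank ℚ (singularHomologyQ A 1) + Module.finrank ℚ (LinearMap.range δ₁) =
      Module.finrank ℚ (LinearMap.ker δ₂) := by
  have (p : PairIdx n) : Module.Finite ℚ (LocallyConstant ↥(S p.1.1 ∩ S p.1.2) ℚ) :=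
    U.finite_locallyConstant (Set.inter_subset_left.trans (U.subset _))
      (U.segment_subset_inter _ _) (hcpt _ _)
  have hker (ψ) : ψ ∈ LinearMap.ker δ₂ ↔ ∀ q x, δ₂ ψ q x = 0 := by
    rw [LinearMap.mem_ker, funext_iff]
    exact forall_congr' fun q => DFunLike.ext_iff
  have hle : LinearMap.range δ₁ ≤ LinearMap.ker δ₂ := by
    rintro _ ⟨φ, rfl⟩
    refine (hker _).2 fun q x => ?_
    rw [hδ₂, hδ₁, hδ₁, hδ₁]
    ring
  obtain ⟨Φ, hΦ, hΦ0⟩ := exists_dual_singularHomology_one A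
  let P₁ : primitiveTriples A S →ₗ[ℚ] Module.Dual ℚ (singularHomologyQ A 1) :=
    Φ ∘ₗ LinearMap.codRestrict _ (LinearMap.fst ℚ _ _ ∘ₗ (primitiveTriples A S).subtype)
      fun t => t.2.1
  have hmem (t : primitiveTriples A S) : t.1.2.2 ∈ LinearMap.ker δ₂ := by
    refine (hker _).2 fun q x => ?_
    have hx : (x : E) ∈ A := U.subset _ x.2.2
    rw [hδ₂]
    linarith [t.2.2.2 ⟨(q.1.2.1, q.1.2.2), q.2.2⟩ ⟨x, hx⟩ ⟨x.2.1.2, x.2.2⟩,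
      t.2.2.2 ⟨(q.1.1, q.1.2.2), lt_trans q.2.1 q.2.2⟩ ⟨x, hx⟩ ⟨x.2.1.1, x.2.2⟩,
      t.2.2.2 ⟨(q.1.1, q.1.2.1), q.2.1⟩ ⟨x, hx⟩ x.2.1]
  let P₂ : primitiveTriples A S →ₗ[ℚ]
      LinearMap.ker δ₂ ⧸ (LinearMap.range δ₁).submoduleOf (LinearMap.ker δ₂) :=
    Submodule.mkQ _ ∘ₗ LinearMap.codRestrict _
      (LinearMap.snd ℚ _ _ ∘ₗ LinearMap.snd ℚ _ _ ∘ₗ (primitiveTriples A S).subtype) hmem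
  have hP₁ : Function.Surjective P₁ := fun z => by
    obtain ⟨c, rfl⟩ := hΦ z
    obtain ⟨t, ht, htc⟩ := U.exists_primitiveTriples_of_cocycle hS c.2
    exact ⟨⟨t, ht⟩, congrArg Φ (Subtype.ext htc)⟩
  have hP₂ : Function.Surjective P₂ := fun z => by
    obtain ⟨ψ, rfl⟩ := Submodule.mkQ_surjective _ z
    obtain ⟨t, ht, htψ⟩ := U.exists_primitiveTriples_of_nerve_cocycle ψ.1 fun q x hx =>
      (hδ₂ ψ.1 q ⟨x, hx⟩).symm.trans ((hker _).1 ψ.2 q ⟨x, hx⟩)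
    exact ⟨⟨t, ht⟩, congrArg (Submodule.mkQ _)
      (Subtype.ext htψ : (⟨t.2.2, hmem ⟨t, ht⟩⟩ : LinearMap.ker δ₂) = ψ)⟩
  have hkers : LinearMap.ker P₁ = LinearMap.ker P₂ := by
    ext t
    rw [LinearMap.mem_ker, LinearMap.mem_ker]
    refine (hΦ0 _).trans ((isSingularCoboundary_iff_of_mem_primitiveTriples U t.2).trans ?_)
    refine Iff.trans ?_ (Submodule.Quotient.mk_eq_zero _).symm
    refine exists_congr fun φ => ?_
    rw [funext_iff]
    refine forall_congr' fun p => ?_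
    rw [DFunLike.ext_iff]
    refine forall_congr' fun x => ?_
    rw [hδ₁]
    rfl
  have hdim := ((P₁.quotKerEquivOfSurjective hP₁).symm.trans ((Submodule.quotEquivOfEq _ _
    hkers).trans (P₂.quotKerEquivOfSurjective hP₂))).finrank_eq
  rw [Subspace.dual_finrank_eq] at hdim
  rw [hdim, ← (Submodule.submoduleOfEquivOfLe hle).finrank_eq]
  exact Submodule.finrank_quotient_add_finrank _

end StarCover

end StarCover

namespace Geometry.SimplicialComplex

variable {E : Type} [NormedAddCommGroup E] [NormedSpace ℝ E]

theorem isCompact_space (K : SimplicialComplex ℝ E) (hK : K.faces.Finite) : IsCompact K.space :=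
  hK.isCompact_biUnion fun s _ => s.finite_toSet.isCompact_convexHull ℝ

/-- A finite cover of a finite simplicial complex by subcomplexes is a star cover. -/
def starCover {n : ℕ} (K : SimplicialComplex ℝ E) (hK : K.faces.Finite)
    (L : Fin n → SimplicialComplex ℝ E) (hL : ∀ i, (L i).faces ⊆ K.faces)
    (hcover : K.space = ⋃ i, (L i).space) : StarCover K.space fun i => (L i).space where
  cover := hcover
  nhd x := (⋃ s ∈ {s ∈ K.faces | x ∉ convexHull ℝ (s : Set E)}, convexHull ℝ (s : Set E))ᶜ
  isOpen_nhd x := ((hK.subset (Set.sep_subset _ _)).isClosed_biUnion fun s _ =>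
    (s.finite_toSet.isCompact_convexHull ℝ).isClosed).isOpen_compl
  mem_nhd x _ hx := by
    obtain ⟨s, hs, hxs⟩ := Set.mem_iUnion₂.1 hx
    exact hs.2 hxs
  segment_subset x _ y hy i hyi := by
    obtain ⟨s, hs, hys⟩ := mem_space_iff.1 hyi
    have hxs : x ∈ convexHull ℝ (s : Set E) := by
      by_contra hxs
      exact hy (Set.mem_iUnion₂.2 ⟨s, ⟨hL i hs, hxs⟩, hys⟩)
    exact ((convex_convexHull ℝ _).segment_subset hxs hys).trans (convexHull_subset_space hs)

end Geometry.SimplicialComplex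

/-- Let `K` be a finite simplicial complex in `ℝ^N` with polyhedron `A = |K|`, covered by the
polyhedra `A_i = |K_i|` of subcomplexes `K_1,…,K_n`, each `A_i` nonempty and `ℚ`-acyclic.
Let `δ₁`, `δ₂` be the generalized restriction maps between the spaces of locally constant
`ℚ`-valued functions on the `A_i`, the pairwise intersections `A_{i,j}` and the triplewise
intersections `A_{i,j,l}`.  Then `b₁(A) = dim_ℚ ker δ₂ - dim_ℚ im δ₁`. -/
theorem first_betti_number_from_acyclic_covering
    (N n : ℕ)
    (K : Geometry.SimplicialComplex ℝ (Fin N → ℝ))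
    (hKfin : K.faces.Finite)
    (𝒦 : Fin n → Geometry.SimplicialComplex ℝ (Fin N → ℝ))
    (hsub : ∀ i, (𝒦 i).faces ⊆ K.faces)
    (hcover : K.space = ⋃ i, (𝒦 i).space)
    (hne : ∀ i, ((𝒦 i).space).Nonempty)
    (hacyclic₀ : ∀ i, Module.finrank ℚ ↥(singularHomologyQ ↥((𝒦 i).space) 0) = 1)
    (hacyclicq : ∀ i, ∀ q : ℕ, 0 < q → Subsingleton ↥(singularHomologyQ ↥((𝒦 i).space) q))
    (δ₁ : (∀ i : Fin n, LocallyConstant ↥((𝒦 i).space) ℚ) →ₗ[ℚ]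
          ∀ p : PairIdx n, LocallyConstant ↥((𝒦 p.1.1).space ∩ (𝒦 p.1.2).space) ℚ)
    (hδ₁ : ∀ φ p, δ₁ φ p =
        (φ p.1.2).comap ⟨Set.inclusion (Set.inter_subset_right),
            continuous_inclusion (Set.inter_subset_right)⟩ -
        (φ p.1.1).comap ⟨Set.inclusion (Set.inter_subset_left),
            continuous_inclusion (Set.inter_subset_left)⟩)
    (δ₂ : (∀ p : PairIdx n, LocallyConstant ↥((𝒦 p.1.1).space ∩ (𝒦 p.1.2).space) ℚ) →ₗ[ℚ]
          ∀ q : TripleIdx n,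
            LocallyConstant ↥(((𝒦 q.1.1).space ∩ (𝒦 q.1.2.1).space) ∩ (𝒦 q.1.2.2).space) ℚ)
    (hδ₂ : ∀ ψ q, δ₂ ψ q =
        (ψ ⟨(q.1.2.1, q.1.2.2), q.2.2⟩).comap
          ⟨Set.inclusion inter3_subset_right_right,
            continuous_inclusion inter3_subset_right_right⟩ -
        (ψ ⟨(q.1.1, q.1.2.2), lt_trans q.2.1 q.2.2⟩).comap
          ⟨Set.inclusion inter3_subset_left_right,
            continuous_inclusion inter3_subset_left_right⟩ +
        (ψ ⟨(q.1.1, q.1.2.1), q.2.1⟩).comap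
          ⟨Set.inclusion (Set.inter_subset_left),
            continuous_inclusion (Set.inter_subset_left)⟩) :
    (Module.finrank ℚ ↥(singularHomologyQ ↥K.space 1) : ℤ) =
      (Module.finrank ℚ ↥(LinearMap.ker δ₂) : ℤ) -
      (Module.finrank ℚ ↥(LinearMap.range δ₁) : ℤ) := by
  have hfin (i : Fin n) : (𝒦 i).faces.Finite := hKfin.subset (hsub i)
  have key := (K.starCover hKfin 𝒦 hsub hcover).finrank_singularHomologyQ_one
    (fun i => hacyclicq i 1 one_pos)
    (fun i j => ((𝒦 i).isCompact_space (hfin i)).inter ((𝒦 j).isCompact_space (hfin j)))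
    δ₁ (fun φ p x => by rw [hδ₁]; rfl) δ₂ (fun ψ q x => by rw [hδ₂]; rfl)
  omega

end
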